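/- (Maximum sum-rate value, interior optimum.) Assume P₁ > 0, P₂ > 0, det(H†H) > 0 and |h₁†h₂| ≤ √(P₁P₂) · det(H†H). Then the maximum of det(I_N + H Q_r(ρ) H†) over all ρ ∈ ℂ with |ρ| ≤ 1 equals 1 + P₁‖h₁‖² + P₂‖h₂‖² + P₁P₂ det(H†H) + |h₁†h₂|² / det(H†H), and it is attained at ρ = (|h₁†h₂| / (√(P₁P₂) det(H†H))) · e^{i·arg(h₁†h₂)}. -/

import Mathlib

open Matrix Complex Filter

/-- The `N × 2` matrix with columns `h₁` and `h₂`. -/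
noncomputable def Hm {N : ℕ} (h₁ h₂ : Fin N → ℂ) : Matrix (Fin N) (Fin 2) ℂ :=
  Matrix.of fun i j => if j = 0 then h₁ i else h₂ i

/-- The Hermitian inner product `h₁† h₂ = ∑ i, conj (h₁ i) * h₂ i`. -/
noncomputable def ip {N : ℕ} (h₁ h₂ : Fin N → ℂ) : ℂ :=
  ∑ i, (starRingEnd ℂ) (h₁ i) * h₂ i

/-- The squared Euclidean norm `‖h‖²`. -/
noncomputable def nsq {N : ℕ} (h : Fin N → ℂ) : ℝ :=
  ∑ i, Complex.normSq (h i)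

/-- `det (H† H)`, a nonnegative real number (taken via the real part). -/
noncomputable def detHH {N : ℕ} (h₁ h₂ : Fin N → ℂ) : ℝ :=
  (((Hm h₁ h₂)ᴴ * Hm h₁ h₂).det).re

/-- The relay covariance matrix `Q_r(ρ)` with diagonal `P₁, P₂` and
off-diagonal `ρ √(P₁ P₂)`. -/
noncomputable def Qr (P₁ P₂ : ℝ) (ρ : ℂ) : Matrix (Fin 2) (Fin 2) ℂ :=
  !![(P₁ : ℂ), ρ * (Real.sqrt (P₁ * P₂) : ℂ);
     (starRingEnd ℂ) ρ * (Real.sqrt (P₁ * P₂) : ℂ), (P₂ : ℂ)]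

/-- `det (I_N + H Q_r(ρ) H†)` (a real number, taken via the real part). -/
noncomputable def MACdet {N : ℕ} (h₁ h₂ : Fin N → ℂ) (P₁ P₂ : ℝ) (ρ : ℂ) : ℝ :=
  ((1 + Hm h₁ h₂ * Qr P₁ P₂ ρ * (Hm h₁ h₂)ᴴ).det).re

theorem gram_Hm {N : ℕ} (h₁ h₂ : Fin N → ℂ) :
    (Hm h₁ h₂)ᴴ * Hm h₁ h₂ =
      !![(nsq h₁ : ℂ), ip h₁ h₂; (starRingEnd ℂ) (ip h₁ h₂), (nsq h₂ : ℂ)] := by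
  ext i j
  fin_cases i <;> fin_cases j <;>
    simp [Matrix.mul_apply, Hm, ip, nsq, Complex.normSq_eq_conj_mul_self, mul_comm]

theorem detHH_eq {N : ℕ} (h₁ h₂ : Fin N → ℂ) :
    detHH h₁ h₂ = nsq h₁ * nsq h₂ - Complex.normSq (ip h₁ h₂) := by
  rw [detHH, gram_Hm, Matrix.det_fin_two_of]
  simp [Complex.normSq_apply]

/-- By Sylvester's identity the `N × N` determinant is a `2 × 2` one, quadratic in `ρ`. -/
theorem MACdet_eq {N : ℕ} (h₁ h₂ : Fin N → ℂ) {P₁ P₂ : ℝ} (hP : 0 ≤ P₁ * P₂) (ρ : ℂ) :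
    MACdet h₁ h₂ P₁ P₂ ρ =
      1 + P₁ * nsq h₁ + P₂ * nsq h₂
        + 2 * Real.sqrt (P₁ * P₂) * (ρ * (starRingEnd ℂ) (ip h₁ h₂)).re
        + P₁ * P₂ * (1 - ‖ρ‖ ^ 2) * detHH h₁ h₂ := by
  rw [MACdet, Matrix.mul_assoc, Matrix.det_one_add_mul_comm, Matrix.mul_assoc, gram_Hm,
    detHH_eq, Qr, Matrix.det_fin_two, ← Complex.normSq_eq_norm_sq]
  have hs := Real.mul_self_sqrt hP
  generalize Real.sqrt (P₁ * P₂) = s at hs ⊢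
  rw [← hs]
  simp [Complex.normSq_apply]
  linear_combination (nsq h₁ * nsq h₂ - (ip h₁ h₂).re ^ 2 - (ip h₁ h₂).im ^ 2) * -hs

/-- Maximum sum-rate value, interior optimum. If `P₁, P₂ > 0`,
`det(H†H) > 0` and `|h₁†h₂| ≤ √(P₁P₂)·det(H†H)`, then the maximum of
`det (I_N + H Q_r(ρ) H†)` over `|ρ| ≤ 1` equals
`1 + P₁‖h₁‖² + P₂‖h₂‖² + P₁P₂ det(H†H) + |h₁†h₂|²/det(H†H)`, attained at
`ρ = (|h₁†h₂|/(√(P₁P₂) det(H†H))) · e^{i·arg(h₁†h₂)}`. -/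
theorem stmt4 {N : ℕ} (hN : 0 < N) (h₁ h₂ : Fin N → ℂ) (P₁ P₂ : ℝ)
    (hP₁ : 0 < P₁) (hP₂ : 0 < P₂) (hD : 0 < detHH h₁ h₂)
    (hle : ‖ip h₁ h₂‖ ≤ Real.sqrt (P₁ * P₂) * detHH h₁ h₂) :
    (∀ ρ : ℂ, ‖ρ‖ ≤ 1 →
        MACdet h₁ h₂ P₁ P₂ ρ ≤
          1 + P₁ * nsq h₁ + P₂ * nsq h₂ + P₁ * P₂ * detHH h₁ h₂
            + ‖ip h₁ h₂‖ ^ 2 / detHH h₁ h₂) ∧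
    MACdet h₁ h₂ P₁ P₂
        (((‖ip h₁ h₂‖ / (Real.sqrt (P₁ * P₂) * detHH h₁ h₂) : ℝ) : ℂ)
          * Complex.exp (Complex.I * ((ip h₁ h₂).arg : ℂ))) =
      1 + P₁ * nsq h₁ + P₂ * nsq h₂ + P₁ * P₂ * detHH h₁ h₂
        + ‖ip h₁ h₂‖ ^ 2 / detHH h₁ h₂ := by
  have hP : 0 < P₁ * P₂ := mul_pos hP₁ hP₂
  have hs : 0 < Real.sqrt (P₁ * P₂) := Real.sqrt_pos.2 hP
  have hss := Real.sq_sqrt hP.le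
  simp only [MACdet_eq h₁ h₂ hP.le]
  generalize Real.sqrt (P₁ * P₂) = s at hs hss ⊢
  generalize detHH h₁ h₂ = D at hD ⊢
  rw [← hss]
  constructor
  · intro ρ _
    have hre : (ρ * (starRingEnd ℂ) (ip h₁ h₂)).re ≤ ‖ρ‖ * ‖ip h₁ h₂‖ := by
      simpa using Complex.re_le_norm (ρ * (starRingEnd ℂ) (ip h₁ h₂))
    have hmul := mul_le_mul_of_nonneg_left hre hs.le
    have hsq : 2 * s * ‖ρ‖ * ‖ip h₁ h₂‖ - s ^ 2 * ‖ρ‖ ^ 2 * D ≤ ‖ip h₁ h₂‖ ^ 2 / D := by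
      rw [le_div_iff₀ hD]
      linarith [sq_nonneg (s * ‖ρ‖ * D - ‖ip h₁ h₂‖)]
    linarith
  · generalize ip h₁ h₂ = c
    have hexp : ‖Complex.exp (Complex.I * (c.arg : ℂ))‖ = 1 :=
      Complex.norm_exp_I_mul_ofReal c.arg
    have hpolar : Complex.exp (Complex.I * (c.arg : ℂ)) * (starRingEnd ℂ) c = (‖c‖ : ℂ) := by
      have hc : (starRingEnd ℂ) c =
          ‖c‖ * (starRingEnd ℂ) (Complex.exp (Complex.I * (c.arg : ℂ))) := by
        conv_lhs => rw [← Complex.norm_mul_exp_arg_mul_I c, mul_comm (c.arg : ℂ)]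
        simp
      rw [hc, mul_left_comm, Complex.mul_conj, Complex.normSq_eq_norm_sq, hexp]
      simp
    rw [mul_assoc (Complex.ofReal _), hpolar, ← Complex.ofReal_mul, Complex.ofReal_re, norm_mul,
      hexp, mul_one, Complex.norm_real, Real.norm_eq_abs, sq_abs]
    field_simp
    ring
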